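/- arXiv:2509.14864 — 8 statements merged into one kernel-verified Lean document; each statement's English description precedes it below -/
import Mathlib

section
/- If ε = 1 and 2/9 ≤ σ ≤ 4/7, then the CCG stiffness matrix T_{ε,σ} is row diagonally dominant with positive diagonal: T(i,i) > 0 and T(i,i) ≥ Σ_{j ≠ i} |T(i,j)| for every row i; moreover the inequality is strict for the boundary rows i ∈ {1, 2, 3, N−2, N−1, N}, and equality T(i,i) = Σ_{j ≠ i} |T(i,j)| holds for every interior row 4 ≤ i ≤ N−3. -/
open Matrix Finset

/-- The CCG stiffness matrix `T_{ε,σ}` of size `N × N` (1-based indices `1,…,N`, mesh size `h = 1`). -/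
noncomputable def ccgT (ε σ : ℝ) (N : ℕ) : Matrix (Fin N) (Fin N) ℝ :=
  fun i j =>
    let I := i.val + 1
    let J := j.val + 1
    let a : ℝ := 5*σ/4 - ε/4 + 3/4
    let b : ℝ := ε/16 - 15*σ/16 - 1/16
    let c : ℝ := ε/8 + 3*σ/8 - 3/8
    let d : ℝ := 1/16 - σ/16 - ε/16
    let a₁ : ℝ := 5*σ/4 - 3*ε/16 + 11/16
    let a₀ : ℝ := 13*σ/8 - 5*ε/16 + 13/16
    let b₀ : ℝ := 5/16 - 9*σ/8 - ε/16
    let c₀ : ℝ := 3*ε/16 + 7*σ/16 - 7/16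
    if I = J then
      (if I = 1 ∨ I = N then a₀ else if I = 2 ∨ I = N - 1 then a₁ else a)
    else if J = I + 1 ∨ I = J + 1 then
      (if (I = 1 ∧ J = 2) ∨ (I = 2 ∧ J = 1) ∨ (I = N - 1 ∧ J = N) ∨ (I = N ∧ J = N - 1)
        then b₀ else b)
    else if J = I + 2 ∨ I = J + 2 then
      (if (I = 1 ∧ J = 3) ∨ (I = 3 ∧ J = 1) ∨ (I = N - 2 ∧ J = N) ∨ (I = N ∧ J = N - 2)
        then c₀ else c)
    else if J = I + 3 ∨ I = J + 3 then d
    else 0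

theorem sum_ite_val_eq_add {N : ℕ} (i k : ℕ) (x : ℝ) :
    ∑ j : Fin N, (if j.val = i + k then x else 0) = if i + k < N then x else 0 := by
  rw [Fin.sum_univ_eq_sum_range (fun j => if j = i + k then x else 0), Finset.sum_ite_eq']
  simp only [Finset.mem_range]

theorem sum_ite_eq_val_add {N : ℕ} (i : Fin N) (k : ℕ) (x : ℝ) :
    ∑ j : Fin N, (if i.val = j.val + k then x else 0) = if k ≤ i.val then x else 0 := by
  split_ifs with h
  · rw [Finset.sum_eq_single ⟨i.val - k, by omega⟩]
    · exact if_pos (by simp only; omega)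
    · intro j _ hj
      exact if_neg fun e => hj (Fin.ext (by simp only; omega))
    · simp
  · exact Finset.sum_eq_zero fun j _ => if_neg (by omega)

theorem abs_ccgT_one_of_ne {σ : ℝ} {N : ℕ} (hN : 7 ≤ N) (hσ₁ : 2 / 9 ≤ σ) (hσ₂ : σ ≤ 4 / 7)
    {i j : Fin N} (hij : j ≠ i) :
    |ccgT 1 σ N i j| =
      (if j.val = i.val + 1 then
        (if i.val = 0 ∨ i.val + 2 = N then 9 * σ / 8 - 1 / 4 else 15 * σ / 16) else 0) +
      (if j.val = i.val + 2 then
        (if i.val = 0 ∨ i.val + 3 = N then 1 / 4 - 7 * σ / 16 else 1 / 4 - 3 * σ / 8) else 0) +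
      (if j.val = i.val + 3 then σ / 16 else 0) +
      (if i.val = j.val + 1 then
        (if i.val = 1 ∨ i.val + 1 = N then 9 * σ / 8 - 1 / 4 else 15 * σ / 16) else 0) +
      (if i.val = j.val + 2 then
        (if i.val = 2 ∨ i.val + 1 = N then 1 / 4 - 7 * σ / 16 else 1 / 4 - 3 * σ / 8) else 0) +
      (if i.val = j.val + 3 then σ / 16 else 0) := by
  have hne : j.val ≠ i.val := fun h => hij (Fin.ext h)
  have hi := i.isLt
  have hj := j.isLt
  have hnonpos : ccgT 1 σ N i j ≤ 0 := by
    simp only [ccgT]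
    split_ifs <;> first | omega | linarith
  rw [abs_of_nonpos hnonpos]
  simp only [ccgT]
  grind (splits := 20)

theorem sum_abs_ccgT_one {σ : ℝ} {N : ℕ} (hN : 7 ≤ N) (hσ₁ : 2 / 9 ≤ σ) (hσ₂ : σ ≤ 4 / 7)
    (i : Fin N) :
    ∑ j ∈ Finset.univ.erase i, |ccgT 1 σ N i j| =
      if i.val = 0 ∨ i.val + 1 = N then 3 * σ / 4
      else if i.val = 1 ∨ i.val + 2 = N then 7 * σ / 4
      else if i.val = 2 ∨ i.val + 3 = N then 9 * σ / 8 + 1 / 2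
      else 5 * σ / 4 + 1 / 2 := by
  have hi := i.isLt
  rw [Finset.sum_congr rfl fun j hj => abs_ccgT_one_of_ne hN hσ₁ hσ₂ (Finset.ne_of_mem_erase hj),
    Finset.sum_erase _ (by simp)]
  simp only [Finset.sum_add_distrib, sum_ite_val_eq_add, sum_ite_eq_val_add]
  grind

theorem ccgT_one_diag {σ : ℝ} {N : ℕ} (i : Fin N) :
    ccgT 1 σ N i i =
      if i.val = 0 ∨ i.val + 1 = N then 13 * σ / 8 + 1 / 2 else 5 * σ / 4 + 1 / 2 := by
  simp only [ccgT]
  grind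

/-- If ε = 1 and 2/9 ≤ σ ≤ 4/7, then the CCG stiffness matrix is row
diagonally dominant with positive diagonal; moreover the dominance is strict for the
boundary rows i ∈ {1, 2, 3, N−2, N−1, N}, and equality holds for every interior row
4 ≤ i ≤ N−3. -/
theorem ccgT_diagonally_dominant (ε σ : ℝ) (N : ℕ) (hN : 7 ≤ N)
    (hε : ε = 1) (hσ₁ : 2/9 ≤ σ) (hσ₂ : σ ≤ 4/7) :
    (∀ i : Fin N, 0 < ccgT ε σ N i i ∧
        ∑ j ∈ Finset.univ.erase i, |ccgT ε σ N i j| ≤ ccgT ε σ N i i) ∧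
    (∀ i : Fin N,
        (i.val + 1 = 1 ∨ i.val + 1 = 2 ∨ i.val + 1 = 3 ∨
         i.val + 1 = N - 2 ∨ i.val + 1 = N - 1 ∨ i.val + 1 = N) →
        ∑ j ∈ Finset.univ.erase i, |ccgT ε σ N i j| < ccgT ε σ N i i) ∧
    (∀ i : Fin N, 4 ≤ i.val + 1 → i.val + 1 ≤ N - 3 →
        ccgT ε σ N i i = ∑ j ∈ Finset.univ.erase i, |ccgT ε σ N i j|) := by
  subst hε
  simp only [sum_abs_ccgT_one hN hσ₁ hσ₂, ccgT_one_diag]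
  refine ⟨fun i => ⟨?_, ?_⟩, fun i hi => ?_, fun i hi₁ hi₂ => ?_⟩
  · split_ifs <;> linarith
  · split_ifs <;> linarith
  · split_ifs <;> first | linarith | omega
  · split_ifs <;> first | rfl | omega
end

section
/- If ε = 1 and 2/9 ≤ σ ≤ 4/7, then the CCG stiffness matrix T_{ε,σ} is irreducible: for every subset S of the index set {1,…,N} with S nonempty and S not equal to the full index set, there exist i ∈ S and j ∉ S with T(i,j) ≠ 0. -/
open Matrix Finset

theorem ccgT_ne_zero_of_third_neighbor {σ : ℝ} (hσ : σ ≠ 0) {N : ℕ} {i j : Fin N}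
    (h : j.val = i.val + 3 ∨ i.val = j.val + 3) : ccgT 1 σ N i j ≠ 0 := by
  simp only [ccgT]
  rw [if_neg (by omega), if_neg (by omega), if_neg (by omega), if_pos (by omega)]
  intro h0
  exact hσ (by linarith)

theorem ccgT_ne_zero_of_interior_neighbor {σ : ℝ} (hσ : σ ≠ 0) {N : ℕ} {i j : Fin N}
    (hi : 1 ≤ i.val ∧ i.val + 1 < N) (hj : 1 ≤ j.val ∧ j.val + 1 < N)
    (h : j.val = i.val + 1 ∨ i.val = j.val + 1) : ccgT 1 σ N i j ≠ 0 := by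
  simp only [ccgT]
  rw [if_neg (by omega), if_pos (by omega), if_neg (by omega)]
  intro h0
  exact hσ (by linarith)

/-- If ε = 1 and 2/9 ≤ σ ≤ 4/7, then the CCG stiffness matrix is
irreducible: for every nonempty proper subset S of the index set, there exist
i ∈ S and j ∉ S with `T(i,j) ≠ 0`. -/
theorem ccgT_irreducible (ε σ : ℝ) (N : ℕ) (hN : 7 ≤ N)
    (hε : ε = 1) (hσ₁ : 2/9 ≤ σ) (hσ₂ : σ ≤ 4/7) :
    ∀ S : Set (Fin N), S.Nonempty → S ≠ Set.univ →
      ∃ i ∈ S, ∃ j ∉ S, ccgT ε σ N i j ≠ 0 := by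
  subst hε
  have hσ : σ ≠ 0 := by linarith
  rintro S ⟨s, hs⟩ hS
  by_contra! hclosed
  have mem_of_ne {i j : Fin N} (hij : ccgT 1 σ N i j ≠ 0) (hi : i ∈ S) : j ∈ S := by
    by_contra hj
    exact hij (hclosed i hi j hj)
  have third (i j : Fin N) (h : j.val = i.val + 3) : i ∈ S ↔ j ∈ S :=
    ⟨mem_of_ne (ccgT_ne_zero_of_third_neighbor hσ (.inl h)),
      mem_of_ne (ccgT_ne_zero_of_third_neighbor hσ (.inr h))⟩
  have interior (k : ℕ) (hk : k + 2 < N) :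
      (⟨k + 1, by omega⟩ : Fin N) ∈ S ↔ (⟨1, by omega⟩ : Fin N) ∈ S := by
    induction k with
    | zero => rfl
    | succ k ih =>
      rw [← ih (by omega)]
      constructor <;> refine mem_of_ne (ccgT_ne_zero_of_interior_neighbor hσ ?_ ?_ ?_) <;>
        simp <;> omega
  have all (i : Fin N) : i ∈ S ↔ (⟨1, by omega⟩ : Fin N) ∈ S := by
    obtain ⟨i, hi⟩ := i
    rcases i with _ | k
    · rw [third _ ⟨3, by omega⟩ rfl]
      exact interior 2 (by omega)
    · by_cases hk : k + 2 < N
      · exact interior k hk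
      · rw [← interior (k - 3) (by omega)]
        exact (third _ _ (by simp; omega)).symm
  exact hS (Set.eq_univ_of_forall fun i => (all i).2 ((all s).1 hs))
end

section
/- If ε = 1 and 2/9 ≤ σ ≤ 4/7, then the CCG stiffness matrix T_{ε,σ} is symmetric positive definite; in particular it is nonsingular. -/
open Matrix Finset

/-- A symmetric matrix `A` is the diagonal form of its row sums plus a weighted Laplacian. -/
theorem Matrix.IsSymm.two_mul_dotProduct_mulVec_eq {n : Type*} [Fintype n] {A : Matrix n n ℝ}
    (hA : A.IsSymm) (x : n → ℝ) :
    2 * (x ⬝ᵥ (A *ᵥ x)) =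
      2 * ∑ i, (∑ j, A i j) * x i ^ 2 + ∑ i, ∑ j, -A i j * (x i - x j) ^ 2 := by
  have hswap : ∑ i, ∑ j, A i j * x j ^ 2 = ∑ i, ∑ j, A i j * x i ^ 2 := by
    rw [Finset.sum_comm]
    simp only [hA.apply]
  have hlap : ∑ i, ∑ j, -A i j * (x i - x j) ^ 2 =
      2 * ∑ i, ∑ j, x i * (A i j * x j) - ∑ i, ∑ j, A i j * x i ^ 2
        - ∑ i, ∑ j, A i j * x j ^ 2 := by
    simp only [Finset.mul_sum, ← Finset.sum_sub_distrib]
    exact Finset.sum_congr rfl fun i _ => Finset.sum_congr rfl fun j _ => by ring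
  rw [hlap, hswap]
  have hform : x ⬝ᵥ (A *ᵥ x) = ∑ i, ∑ j, x i * (A i j * x j) := by
    simp only [dotProduct, mulVec, Finset.mul_sum]
  simp only [hform, Finset.sum_mul]
  ring

/-- A weakly diagonally dominant symmetric matrix with nonpositive off-diagonal entries is positive
definite as soon as the rows of positive sum, propagated along the negative entries, separate
vectors from zero. -/
theorem Matrix.IsSymm.posDef_of_sum_row_nonneg {n : Type*} [Fintype n]
    {A : Matrix n n ℝ} (hA : A.IsSymm) (hoff : ∀ i j, i ≠ j → A i j ≤ 0)
    (hrow : ∀ i, 0 ≤ ∑ j, A i j)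
    (hzero : ∀ x : n → ℝ, (∀ i, 0 < ∑ j, A i j → x i = 0) →
      (∀ i j, A i j < 0 → x i = x j) → x = 0) :
    A.PosDef := by
  have hdiag : ∀ x : n → ℝ, ∀ i, 0 ≤ (∑ j, A i j) * x i ^ 2 := fun x i =>
    mul_nonneg (hrow i) (sq_nonneg _)
  have hedge : ∀ x : n → ℝ, ∀ i j, 0 ≤ -A i j * (x i - x j) ^ 2 := by
    intro x i j
    rcases eq_or_ne i j with rfl | hij
    · simp
    · exact mul_nonneg (neg_nonneg.2 (hoff i j hij)) (sq_nonneg _)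
  refine Matrix.PosDef.of_dotProduct_mulVec_pos ?_ fun x hx => ?_
  · rw [Matrix.IsHermitian, conjTranspose_eq_transpose_of_trivial]
    exact hA
  · rw [star_trivial]
    have key := hA.two_mul_dotProduct_mulVec_eq x
    have h₁ : 0 ≤ ∑ i, (∑ j, A i j) * x i ^ 2 := Finset.sum_nonneg fun i _ => hdiag x i
    have h₂ : 0 ≤ ∑ i, ∑ j, -A i j * (x i - x j) ^ 2 :=
      Finset.sum_nonneg fun i _ => Finset.sum_nonneg fun j _ => hedge x i j
    by_contra! hle
    have h₁' : ∑ i, (∑ j, A i j) * x i ^ 2 = 0 := by linarith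
    have h₂' : ∑ i, ∑ j, -A i j * (x i - x j) ^ 2 = 0 := by linarith
    rw [Finset.sum_eq_zero_iff_of_nonneg fun i _ => hdiag x i] at h₁'
    rw [Finset.sum_eq_zero_iff_of_nonneg
      fun i _ => Finset.sum_nonneg fun j _ => hedge x i j] at h₂'
    refine hx (hzero x (fun i hi => ?_) fun i j hij => ?_)
    · simpa [hi.ne'] using h₁' i (Finset.mem_univ i)
    · have hi := h₂' i (Finset.mem_univ i)
      rw [Finset.sum_eq_zero_iff_of_nonneg fun j _ => hedge x i j] at hi
      simpa [hij.ne, sub_eq_zero] using hi j (Finset.mem_univ j)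

theorem Fin.sum_eq_sum_window {M : Type*} [AddCommMonoid M] {N k m : ℕ} (hkm : k + m ≤ N)
    (f : Fin N → M) (hf : ∀ j : Fin N, (j : ℕ) < k ∨ k + m ≤ j → f j = 0) :
    ∑ j, f j = ∑ t : Fin m, f ⟨k + t, by omega⟩ := by
  refine (Fintype.sum_of_injective (fun t : Fin m => (⟨k + t, by omega⟩ : Fin N)) ?_ _ _ ?_ ?_).symm
  · intro s t h
    simp only [Fin.mk.injEq] at h
    omega
  · intro j hj
    apply hf
    by_contra! h
    exact hj ⟨⟨j - k, by omega⟩, by ext; simp; omega⟩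
  · exact fun _ => rfl

theorem ccgT_isSymm (ε σ : ℝ) (N : ℕ) : (ccgT ε σ N).IsSymm := by
  ext i j
  simp only [transpose_apply, ccgT]
  grind

theorem ccgT_rev_rev (ε σ : ℝ) {N : ℕ} (hN : 7 ≤ N) (i j : Fin N) :
    ccgT ε σ N i.rev j.rev = ccgT ε σ N i j := by
  have hi := i.isLt
  have hj := j.isLt
  simp only [ccgT, Fin.val_rev]
  refine if_congr (by omega) (if_congr (by omega) rfl (if_congr (by omega) rfl rfl))
    (if_congr (by omega) (if_congr (by omega) rfl rfl)
      (if_congr (by omega) (if_congr (by omega) rfl rfl) (if_congr (by omega) rfl rfl)))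

theorem ccgT_eq_zero (ε σ : ℝ) {N : ℕ} {i j : Fin N}
    (h : (i : ℕ) + 3 < j ∨ (j : ℕ) + 3 < i) : ccgT ε σ N i j = 0 := by
  simp only [ccgT]
  grind

theorem ccgT_one_add_three {σ : ℝ} {N : ℕ} {i j : Fin N} (h : (j : ℕ) = i + 3) :
    ccgT 1 σ N i j = -σ / 16 := by
  simp only [ccgT]
  grind

theorem ccgT_one_off_diag_nonpos {σ : ℝ} {N : ℕ} (hσ₁ : 2 / 9 ≤ σ) (hσ₂ : σ ≤ 4 / 7)
    {i j : Fin N} (hij : i ≠ j) : ccgT 1 σ N i j ≤ 0 := by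
  have hne : (i : ℕ) + 1 ≠ j + 1 := fun h => hij (Fin.ext (by omega))
  simp only [ccgT, if_neg hne]
  split_ifs <;> linarith

theorem ccgT_one_sum_row_zero (σ : ℝ) {N : ℕ} (hN : 7 ≤ N) :
    ∑ j, ccgT 1 σ N ⟨0, by omega⟩ j = 1 / 2 + 7 * σ / 8 := by
  rw [Fin.sum_eq_sum_window (k := 0) (m := 4) (by omega) _
    fun j hj => ccgT_eq_zero _ _ (by simp only; omega)]
  simp only [Fin.sum_univ_succ, Fin.sum_univ_zero, ccgT, Fin.val_succ, Fin.val_zero]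
  grind

theorem ccgT_one_sum_row_one (σ : ℝ) {N : ℕ} (hN : 7 ≤ N) :
    ∑ j, ccgT 1 σ N ⟨1, by omega⟩ j = 1 / 2 - σ / 2 := by
  rw [Fin.sum_eq_sum_window (k := 0) (m := 5) (by omega) _
    fun j hj => ccgT_eq_zero _ _ (by simp only; omega)]
  simp only [Fin.sum_univ_succ, Fin.sum_univ_zero, ccgT, Fin.val_succ, Fin.val_zero]
  grind

theorem ccgT_one_sum_row_two (σ : ℝ) {N : ℕ} (hN : 7 ≤ N) :
    ∑ j, ccgT 1 σ N ⟨2, by omega⟩ j = σ / 8 := by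
  rw [Fin.sum_eq_sum_window (k := 0) (m := 6) (by omega) _
    fun j hj => ccgT_eq_zero _ _ (by simp only; omega)]
  simp only [Fin.sum_univ_succ, Fin.sum_univ_zero, ccgT, Fin.val_succ, Fin.val_zero]
  grind

theorem ccgT_one_sum_row_interior (σ : ℝ) {N k : ℕ} (hk : k + 7 ≤ N) :
    ∑ j, ccgT 1 σ N ⟨k + 3, by omega⟩ j = 0 := by
  rw [Fin.sum_eq_sum_window (k := k) (m := 7) (by omega) _
    fun j hj => ccgT_eq_zero _ _ (by simp only; omega)]
  simp only [Fin.sum_univ_succ, Fin.sum_univ_zero, ccgT, Fin.val_succ, Fin.val_zero]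
  grind

theorem ccgT_one_sum_row_pos {σ : ℝ} {N : ℕ} (hN : 7 ≤ N) (hσ₀ : 0 < σ) (hσ₁ : σ < 1)
    {i : Fin N} (hi : (i : ℕ) < 3) : 0 < ∑ j, ccgT 1 σ N i j := by
  obtain ⟨i, hiN⟩ := i
  simp only at hi
  interval_cases i
  · rw [ccgT_one_sum_row_zero σ hN]; linarith
  · rw [ccgT_one_sum_row_one σ hN]; linarith
  · rw [ccgT_one_sum_row_two σ hN]; linarith

theorem ccgT_sum_row_rev (ε σ : ℝ) {N : ℕ} (hN : 7 ≤ N) (i : Fin N) :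
    ∑ j, ccgT ε σ N i.rev j = ∑ j, ccgT ε σ N i j := by
  rw [← Equiv.sum_comp Fin.revPerm]
  simp only [Fin.revPerm_apply, ccgT_rev_rev ε σ hN]

theorem ccgT_one_sum_row_nonneg {σ : ℝ} {N : ℕ} (hN : 7 ≤ N) (hσ₀ : 0 < σ) (hσ₁ : σ < 1)
    (i : Fin N) : 0 ≤ ∑ j, ccgT 1 σ N i j := by
  rcases lt_or_ge (i : ℕ) 3 with hi | hi
  · exact (ccgT_one_sum_row_pos hN hσ₀ hσ₁ hi).le
  rcases lt_or_ge (i.rev : ℕ) 3 with hr | hr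
  · rw [← ccgT_sum_row_rev 1 σ hN]
    exact (ccgT_one_sum_row_pos hN hσ₀ hσ₁ hr).le
  · obtain ⟨i, hiN⟩ := i
    rw [Fin.val_rev] at hr
    obtain ⟨k, rfl⟩ := Nat.exists_eq_add_of_le' hi
    simp only at hr
    exact (ccgT_one_sum_row_interior σ (by omega)).ge

/-- If ε = 1 and 2/9 ≤ σ ≤ 4/7, then the CCG stiffness matrix is symmetric
positive definite; in particular it is nonsingular. -/
theorem ccgT_posDef (ε σ : ℝ) (N : ℕ) (hN : 7 ≤ N)
    (hε : ε = 1) (hσ₁ : 2/9 ≤ σ) (hσ₂ : σ ≤ 4/7) :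
    (ccgT ε σ N).IsSymm ∧ (ccgT ε σ N).PosDef ∧ IsUnit (ccgT ε σ N).det := by
  subst hε
  have hσ₀ : 0 < σ := by linarith
  have hσ_lt : σ < 1 := by linarith
  have hpos : (ccgT 1 σ N).PosDef := by
    refine (ccgT_isSymm 1 σ N).posDef_of_sum_row_nonneg
      (fun i j => ccgT_one_off_diag_nonpos hσ₁ hσ₂)
      (ccgT_one_sum_row_nonneg hN hσ₀ hσ_lt) fun x hrow hedge => ?_
    have hx : ∀ (k : ℕ) (hk : k < N), x ⟨k, hk⟩ = 0 := by
      intro k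
      induction k using Nat.strong_induction_on with
      | _ k ih =>
        intro hk
        rcases lt_or_ge k 3 with h | h
        · exact hrow _ (ccgT_one_sum_row_pos hN hσ₀ hσ_lt h)
        · rw [← ih (k - 3) (by omega) (by omega)]
          refine (hedge _ _ ?_).symm
          rw [ccgT_one_add_three (by simp only; omega)]
          linarith
    exact funext fun i => hx i i.isLt
  exact ⟨ccgT_isSymm 1 σ N, hpos, hpos.det_pos.ne'.isUnit⟩
end

section
/- If ε = 1 and 2/9 ≤ σ ≤ 4/7, then the CCG stiffness matrix T_{ε,σ} is a nonsingular M-matrix: it is invertible and every entry of its inverse is nonnegative. -/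
open Matrix Finset

/-- Discrete minimum principle: a matrix with nonpositive off-diagonal entries and nonnegative row
sums, each row of which has a positive sum or a negative entry left of the diagonal, maps only
nonnegative vectors to nonnegative vectors. -/
theorem Matrix.nonneg_of_mulVec_nonneg_of_rowSum {n : ℕ} (A : Matrix (Fin n) (Fin n) ℝ)
    (hoff : ∀ i j, i ≠ j → A i j ≤ 0) (hrow : ∀ i, 0 ≤ ∑ j, A i j)
    (hchain : ∀ i, 0 < ∑ j, A i j ∨ ∃ j < i, A i j < 0)
    (x : Fin n → ℝ) (hx : ∀ i, 0 ≤ (A *ᵥ x) i) (i : Fin n) : 0 ≤ x i := by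
  by_contra! hneg
  obtain ⟨m, -, hm⟩ := Finset.exists_min_image Finset.univ x ⟨i, Finset.mem_univ i⟩
  have hmin : (Finset.univ.filter fun k => x k = x m).Nonempty := ⟨m, by simp⟩
  obtain ⟨k, hk, hfirst⟩ := Finset.exists_min_image _ id hmin
  rw [Finset.mem_filter] at hk
  have hle : ∀ j, x k ≤ x j := fun j => hk.2 ▸ hm j (Finset.mem_univ j)
  have hxk : x k < 0 := (hle i).trans_lt hneg
  have hsplit : (A *ᵥ x) k = ∑ j, A k j * (x j - x k) + (∑ j, A k j) * x k := by
    simp only [Matrix.mulVec, dotProduct]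
    rw [Finset.sum_mul, ← Finset.sum_add_distrib]
    exact Finset.sum_congr rfl fun j _ => by ring
  have hterm : ∀ j ∈ Finset.univ, A k j * (x j - x k) ≤ 0 := fun j _ => by
    rcases eq_or_ne k j with rfl | h
    · simp
    · exact mul_nonpos_of_nonpos_of_nonneg (hoff k j h) (sub_nonneg.2 (hle j))
  have hsum := Finset.sum_nonpos hterm
  have hAx := hx k
  rcases hchain k with hpos | ⟨j, hjk, hj⟩
  · nlinarith [mul_neg_of_pos_of_neg hpos hxk]
  · have hlt : x k < x j := lt_of_le_of_ne (hle j) fun h =>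
      absurd (hfirst j (by simp [← h, hk.2])) (not_le.2 hjk)
    have hneg' := Finset.sum_neg' hterm
      ⟨j, Finset.mem_univ j, mul_neg_of_neg_of_pos hj (sub_pos.2 hlt)⟩
    nlinarith [mul_nonpos_of_nonneg_of_nonpos (hrow k) hxk.le]

/-- A square matrix which maps only nonnegative vectors to nonnegative vectors is monotone. -/
theorem Matrix.isUnit_det_and_inv_nonneg {n : ℕ} (A : Matrix (Fin n) (Fin n) ℝ)
    (h : ∀ x : Fin n → ℝ, (∀ i, 0 ≤ (A *ᵥ x) i) → ∀ i, 0 ≤ x i) :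
    IsUnit A.det ∧ ∀ i j, 0 ≤ A⁻¹ i j := by
  have hdet : IsUnit A.det := by
    rw [isUnit_iff_ne_zero]
    intro h0
    obtain ⟨v, hv, hAv⟩ := Matrix.exists_mulVec_eq_zero_iff.2 h0
    refine hv (funext fun i => le_antisymm ?_ (h v (by simp [hAv]) i))
    simpa using h (-v) (by simp [Matrix.mulVec_neg, hAv]) i
  refine ⟨hdet, fun i j => h (fun k => A⁻¹ k j) (fun k => ?_) i⟩
  change 0 ≤ (A * A⁻¹) k j
  rw [Matrix.mul_nonsing_inv A hdet, Matrix.one_apply]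
  split_ifs <;> norm_num

/-- A sum over `Fin N` of a function supported in a window of length `m`. -/
theorem Fin.sum_univ_eq_sum_window (f : ℕ → ℝ) (N l m : ℕ) (hlm : l + m ≤ N)
    (hf : ∀ j < N, j < l ∨ l + m ≤ j → f j = 0) :
    ∑ j : Fin N, f j = ∑ k ∈ Finset.range m, f (l + k) := by
  rw [Fin.sum_univ_eq_sum_range, Finset.range_eq_Ico,
    ← Finset.sum_subset (Finset.Ico_subset_Ico (Nat.zero_le l) hlm), Finset.sum_Ico_eq_sum_range]
  · simp
  · intro j hj hj'
    simp only [Finset.mem_Ico] at hj hj'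
    exact hf j hj.2 (by omega)

/-- The entry of `ccgT 1 σ N` in row `i` and column `j`, counted from `0`. -/
noncomputable def ccgEntry (σ : ℝ) (N i j : ℕ) : ℝ :=
  if i = j then
    (if i = 0 ∨ i + 1 = N then 13*σ/8 + 1/2 else 5*σ/4 + 1/2)
  else if j = i + 1 ∨ i = j + 1 then
    (if i = 0 ∨ j = 0 ∨ i + 1 = N ∨ j + 1 = N then 1/4 - 9*σ/8 else -(15*σ/16))
  else if j = i + 2 ∨ i = j + 2 then
    (if i = 0 ∨ j = 0 ∨ i + 1 = N ∨ j + 1 = N then 7*σ/16 - 1/4 else 3*σ/8 - 1/4)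
  else if j = i + 3 ∨ i = j + 3 then -(σ/16)
  else 0

theorem ccgT_one_apply (σ : ℝ) (N : ℕ) (hN : 7 ≤ N) (i j : Fin N) :
    ccgT 1 σ N i j = ccgEntry σ N i j := by
  obtain ⟨i, hi⟩ := i
  obtain ⟨j, hj⟩ := j
  simp only [ccgT, ccgEntry]
  split_ifs <;> first | omega | ring

theorem ccgEntry_nonpos (σ : ℝ) (hσ₁ : 2/9 ≤ σ) (hσ₂ : σ ≤ 4/7) (N i j : ℕ) (hij : i ≠ j) :
    ccgEntry σ N i j ≤ 0 := by
  simp only [ccgEntry, if_neg hij]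
  split_ifs <;> linarith

theorem ccgEntry_sub_one_neg (σ : ℝ) (hσ : 0 < σ) (N i : ℕ) (hi : 2 ≤ i) (hiN : i + 1 < N) :
    ccgEntry σ N i (i - 1) < 0 := by
  simp only [ccgEntry]
  split_ifs <;> first | omega | linarith

theorem ccgEntry_sum (σ : ℝ) (N : ℕ) (hN : 7 ≤ N) (i : ℕ) (hi : i < N) :
    ∑ j : Fin N, ccgEntry σ N i j =
      if i = 0 ∨ i + 1 = N then 1/2 + 7*σ/8
      else if i = 1 ∨ i + 2 = N then (1 - σ)/2
      else if i = 2 ∨ i + 3 = N then σ/8 else 0 := by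
  have hwindow (l m : ℕ) (hlm : l + m ≤ N) (hl : l = 0 ∨ l + 3 ≤ i)
      (hm : l + m = N ∨ i + 3 < l + m) :
      ∑ j : Fin N, ccgEntry σ N i j = ∑ k ∈ Finset.range m, ccgEntry σ N i (l + k) := by
    refine Fin.sum_univ_eq_sum_window _ N l m hlm fun j hj h => ?_
    simp only [ccgEntry]
    split_ifs <;> first | omega | rfl
  obtain ⟨n, rfl⟩ : ∃ n, N = n + 7 := ⟨N - 7, by omega⟩
  obtain rfl | rfl | rfl | rfl | rfl | rfl | ⟨k, hk, rfl⟩ : i = 0 ∨ i = 1 ∨ i = 2 ∨ i = n + 4 ∨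
      i = n + 5 ∨ i = n + 6 ∨ ∃ k, k < n + 1 ∧ i = k + 3 := by
    by_cases h : 3 ≤ i ∧ i < n + 4
    · exact .inr <| .inr <| .inr <| .inr <| .inr <| .inr ⟨i - 3, by omega, by omega⟩
    · omega
  · rw [hwindow 0 4 (by omega) (by omega) (by omega)]
    simp [Finset.sum_range_succ, ccgEntry]
    ring
  · rw [hwindow 0 5 (by omega) (by omega) (by omega)]
    simp [Finset.sum_range_succ, ccgEntry]
    ring
  · rw [hwindow 0 6 (by omega) (by omega) (by omega)]
    simp [Finset.sum_range_succ, ccgEntry]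
    ring
  · rw [hwindow (n + 1) 6 (by omega) (by omega) (by omega)]
    simp [Finset.sum_range_succ, ccgEntry, add_assoc]
    ring
  · rw [hwindow (n + 2) 5 (by omega) (by omega) (by omega)]
    simp [Finset.sum_range_succ, ccgEntry, add_assoc]
    ring
  · rw [hwindow (n + 3) 4 (by omega) (by omega) (by omega)]
    simp [Finset.sum_range_succ, ccgEntry, add_assoc]
    ring
  · rw [hwindow k 7 (by omega) (by omega) (by omega)]
    have h5 : k ≠ n + 5 := by omega
    have h4 : k ≠ n + 4 := by omega
    have h1 : k ≠ n + 3 := by omega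
    have h2 : k ≠ n + 2 := by omega
    have h3 : k ≠ n + 1 := by omega
    simp [Finset.sum_range_succ, ccgEntry, add_assoc, h1, h2, h3, h4, h5]
    ring

/-- If ε = 1 and 2/9 ≤ σ ≤ 4/7, then the CCG stiffness matrix is a
nonsingular M-matrix: its off-diagonal entries are nonpositive, it is invertible, and
every entry of its inverse is nonnegative. -/
theorem ccgT_Mmatrix_of_eps_one (ε σ : ℝ) (N : ℕ) (hN : 7 ≤ N)
    (hε : ε = 1) (hσ₁ : 2/9 ≤ σ) (hσ₂ : σ ≤ 4/7) :
    (∀ i j : Fin N, i ≠ j → ccgT ε σ N i j ≤ 0) ∧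
    IsUnit (ccgT ε σ N).det ∧
    (∀ i j : Fin N, 0 ≤ (ccgT ε σ N)⁻¹ i j) := by
  subst hε
  have hoff : ∀ i j : Fin N, i ≠ j → ccgT 1 σ N i j ≤ 0 := fun i j hij => by
    rw [ccgT_one_apply σ N hN]
    exact ccgEntry_nonpos σ hσ₁ hσ₂ N i j (Fin.val_ne_of_ne hij)
  have hsum (i : Fin N) := ccgEntry_sum σ N hN i i.isLt
  refine ⟨hoff, Matrix.isUnit_det_and_inv_nonneg _
    (Matrix.nonneg_of_mulVec_nonneg_of_rowSum _ hoff (fun i => ?_) fun i => ?_)⟩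
  · simp only [ccgT_one_apply σ N hN, hsum]
    split_ifs <;> linarith
  · simp only [ccgT_one_apply σ N hN, hsum]
    by_cases hi : 2 ≤ i.val ∧ i.val + 1 < N
    · exact .inr ⟨⟨i - 1, by omega⟩, Fin.lt_def.2 (by simp only; omega),
        ccgEntry_sub_one_neg σ (by linarith) N i hi.1 hi.2⟩
    · left
      have := i.isLt
      split_ifs <;> first | omega | linarith
end

section
/- If ε = 0 and σ = 1, then the CCG stiffness matrix T_{ε,σ} is a nonsingular M-matrix: its off-diagonal entries are nonpositive, it is invertible, and every entry of its inverse is nonnegative. -/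
open Matrix Finset

/-- A matrix with nonpositive off-diagonal entries that maps some positive vector to a positive
vector satisfies the minimum principle. -/
theorem nonneg_of_mulVec_nonneg {ι : Type*} [Fintype ι] {A : Matrix ι ι ℝ} {w : ι → ℝ}
    (hA : ∀ i j, i ≠ j → A i j ≤ 0) (hw : ∀ i, 0 < w i) (hAw : ∀ i, 0 < (A *ᵥ w) i)
    {x : ι → ℝ} (hx : ∀ i, 0 ≤ (A *ᵥ x) i) (k : ι) : 0 ≤ x k := by
  obtain ⟨i, -, hi⟩ := Finset.exists_min_image Finset.univ (fun j => x j / w j) ⟨k, mem_univ k⟩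
  set m := x i / w i with hm
  have hmin : ∀ j, m * w j ≤ x j := fun j => (le_div_iff₀ (hw j)).1 (hi j (mem_univ j))
  suffices 0 ≤ m from (mul_nonneg this (hw k).le).trans (hmin k)
  have hle : (A *ᵥ x) i ≤ m * (A *ᵥ w) i := by
    simp only [mulVec, dotProduct, Finset.mul_sum]
    refine Finset.sum_le_sum fun j _ => ?_
    by_cases hij : i = j
    · subst hij
      have : x i = m * w i := (div_mul_cancel₀ _ (hw i).ne').symm
      rw [this]
      exact le_of_eq (by ring)
    · nlinarith [mul_le_mul_of_nonpos_left (hmin j) (hA i j hij)]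
  exact nonneg_of_mul_nonneg_left ((hx i).trans hle) (hAw i)

/-- A matrix with nonpositive off-diagonal entries that maps some positive vector to a positive
vector is monotone. -/
theorem isUnit_det_and_inv_nonneg_of_mulVec_pos {ι : Type*} [Fintype ι] [DecidableEq ι]
    {A : Matrix ι ι ℝ} {w : ι → ℝ} (hA : ∀ i j, i ≠ j → A i j ≤ 0) (hw : ∀ i, 0 < w i)
    (hAw : ∀ i, 0 < (A *ᵥ w) i) : IsUnit A.det ∧ ∀ i j, 0 ≤ A⁻¹ i j := by
  have hdet : IsUnit A.det := by
    rw [isUnit_iff_ne_zero]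
    intro h0
    obtain ⟨v, hv, hAv⟩ := Matrix.exists_mulVec_eq_zero_iff.2 h0
    refine hv (funext fun k => le_antisymm ?_ ?_)
    · have := nonneg_of_mulVec_nonneg hA hw hAw (x := -v) (by simp [mulVec_neg, hAv]) k
      simpa using this
    · exact nonneg_of_mulVec_nonneg hA hw hAw (by simp [hAv]) k
  refine ⟨hdet, fun i j => ?_⟩
  refine nonneg_of_mulVec_nonneg hA hw hAw (x := fun k => A⁻¹ k j) (fun k => ?_) i
  have : (A *ᵥ fun k => A⁻¹ k j) k = (A * A⁻¹) k j := rfl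
  rw [this, mul_nonsing_inv A hdet, one_apply]
  split_ifs <;> norm_num

/-- For `ε = 0` and `σ = 1` the CCG stiffness matrix is tridiagonal. -/
theorem ccgT_zero_one (N : ℕ) (i j : Fin N) :
    ccgT 0 1 N i j =
      if i.val = j.val then
        (if i.val = 0 ∨ i.val + 1 = N then 39 / 16
          else if i.val = 1 ∨ i.val + 1 = N - 1 then 31 / 16 else 2)
      else if j.val = i.val + 1 ∨ i.val = j.val + 1 then
        (if i.val = 0 ∨ j.val = 0 ∨ i.val + 1 = N ∨ j.val + 1 = N then -13 / 16 else -1)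
      else 0 := by
  have := i.isLt
  have := j.isLt
  simp only [ccgT]
  split_ifs <;> first | omega | norm_num

theorem ccgT_zero_one_nonpos (N : ℕ) (i j : Fin N) (hij : i ≠ j) : ccgT 0 1 N i j ≤ 0 := by
  rw [ccgT_zero_one, if_neg (Fin.val_ne_of_ne hij)]
  split_ifs <;> norm_num

theorem ccgT_zero_one_mulVec_pos (N : ℕ) (hN : 7 ≤ N) (i : Fin N) :
    0 < (ccgT 0 1 N *ᵥ fun j => 1 + ((j.val : ℝ) + 1) * (N - j.val)) i := by
  have hN' : (7 : ℝ) ≤ N := by exact_mod_cast hN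
  obtain ⟨n, hn⟩ := i
  simp only [mulVec, dotProduct]
  by_cases h0 : n = 0
  · subst h0
    rw [← Finset.sum_subset (subset_univ {⟨0, hn⟩, ⟨1, by omega⟩}) (fun j _ hj => by
      simp only [Finset.mem_insert, Finset.mem_singleton, Fin.ext_iff] at hj
      rw [ccgT_zero_one, if_neg (by simp only; omega), if_neg (by simp only; omega), zero_mul]),
      Finset.sum_pair (by simp)]
    simp only [ccgT_zero_one]
    norm_num
    linarith
  by_cases h1 : n + 1 = N
  · have hc : (N : ℝ) = n + 1 := by exact_mod_cast h1.symm
    rw [← Finset.sum_subset (subset_univ {⟨n, hn⟩, ⟨n - 1, by omega⟩}) (fun j _ hj => by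
      simp only [Finset.mem_insert, Finset.mem_singleton, Fin.ext_iff] at hj
      have := j.isLt
      rw [ccgT_zero_one, if_neg (by simp only; omega), if_neg (by simp only; omega), zero_mul]),
      Finset.sum_pair (by simp only [ne_eq, Fin.mk.injEq]; omega)]
    simp only [ccgT_zero_one]
    rw [if_pos trivial, if_pos (by omega), if_neg (by omega), if_pos (by omega),
      if_pos (by omega), Nat.cast_pred (by omega), hc]
    linarith
  · have h2 : (n : ℝ) + 2 ≤ N := by exact_mod_cast (by omega : n + 2 ≤ N)
    rw [← Finset.sum_subset (subset_univ {⟨n, hn⟩, ⟨n - 1, by omega⟩, ⟨n + 1, by omega⟩})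
      (fun j _ hj => by
        simp only [Finset.mem_insert, Finset.mem_singleton, Fin.ext_iff] at hj
        rw [ccgT_zero_one, if_neg (by simp only; omega), if_neg (by simp only; omega), zero_mul]),
      Finset.sum_insert (by
        simp only [Finset.mem_insert, Finset.mem_singleton, Fin.mk.injEq]; omega),
      Finset.sum_pair (by simp only [ne_eq, Fin.mk.injEq]; omega)]
    simp only [ccgT_zero_one]
    rw [if_pos trivial, if_neg (by omega : ¬ (n = 0 ∨ n + 1 = N)), if_neg (by omega : n ≠ n - 1),
      if_pos (by omega : n - 1 = n + 1 ∨ n = n - 1 + 1), if_neg (by omega : n ≠ n + 1),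
      if_pos (Or.inl trivial), Nat.cast_pred (by omega)]
    push_cast
    by_cases hl : n = 1
    · subst hl
      norm_num
      rw [if_neg (by omega)]
      linarith
    by_cases hr : n + 1 = N - 1
    · have hc : (N : ℝ) = n + 2 := by exact_mod_cast (by omega : N = n + 2)
      rw [if_pos (by omega), if_neg (by omega), if_pos (by omega), hc]
      linarith
    · rw [if_neg (by omega), if_neg (by omega), if_neg (by rw [false_or]; omega)]
      linarith

/-- If ε = 0 and σ = 1, then the CCG stiffness matrix is a nonsingular
M-matrix: its off-diagonal entries are nonpositive, it is invertible, and every entry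
of its inverse is nonnegative. -/
theorem ccgT_Mmatrix_of_eps_zero (ε σ : ℝ) (N : ℕ) (hN : 7 ≤ N)
    (hε : ε = 0) (hσ : σ = 1) :
    (∀ i j : Fin N, i ≠ j → ccgT ε σ N i j ≤ 0) ∧
    IsUnit (ccgT ε σ N).det ∧
    (∀ i j : Fin N, 0 ≤ (ccgT ε σ N)⁻¹ i j) := by
  subst hε hσ
  refine ⟨ccgT_zero_one_nonpos N, isUnit_det_and_inv_nonneg_of_mulVec_pos
    (ccgT_zero_one_nonpos N) (fun j => ?_) (ccgT_zero_one_mulVec_pos N hN)⟩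
  have : (j.val : ℝ) < N := by exact_mod_cast j.isLt
  have : 0 < (N : ℝ) - j.val := by linarith
  positivity
end

section
/- If 1 < σ ≤ (104√2 − 12)/79, then the tridiagonal Toeplitz matrix T_m with diagonal A = (31σ+8)/16 and off-diagonal B = (4−17σ)/16 is monotone: it is invertible and every entry of its inverse is nonnegative. -/
open Matrix

/-- The symmetric pentadiagonal Toeplitz matrix `T_M` with diagonal `A = (31σ+8)/16`,
first off-diagonal `B = (4−17σ)/16`, and second off-diagonal `C = (σ−1)/4`. -/
noncomputable def toepTM (σ : ℝ) (N : ℕ) : Matrix (Fin N) (Fin N) ℝ :=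
  fun i j =>
    if i.val = j.val then (31*σ + 8)/16
    else if j.val = i.val + 1 ∨ i.val = j.val + 1 then (4 - 17*σ)/16
    else if j.val = i.val + 2 ∨ i.val = j.val + 2 then (σ - 1)/4
    else 0

/-- The symmetric tridiagonal Toeplitz matrix `T_m` with diagonal `A = (31σ+8)/16`
and off-diagonal `B = (4−17σ)/16`. -/
noncomputable def toepTm (σ : ℝ) (N : ℕ) : Matrix (Fin N) (Fin N) ℝ :=
  fun i j =>
    if i.val = j.val then (31*σ + 8)/16
    else if j.val = i.val + 1 ∨ i.val = j.val + 1 then (4 - 17*σ)/16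
    else 0

namespace Matrix

variable {n : Type*} [Fintype n]

/-- Minimum principle: if the off-diagonal entries of `M` are nonpositive and its row sums are
positive, then `M *ᵥ x ≥ 0` forces `x ≥ 0`. -/
theorem nonneg_of_mulVec_nonneg {M : Matrix n n ℝ}
    (hoff : ∀ i j, i ≠ j → M i j ≤ 0) (hrow : ∀ i, 0 < ∑ j, M i j)
    {x : n → ℝ} (hx : ∀ i, 0 ≤ (M *ᵥ x) i) (k : n) : 0 ≤ x k := by
  obtain ⟨i, -, hi⟩ := Finset.exists_min_image Finset.univ x ⟨k, Finset.mem_univ k⟩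
  refine le_trans ?_ (hi k (Finset.mem_univ k))
  have hle : (M *ᵥ x) i ≤ (∑ j, M i j) * x i := by
    rw [Finset.sum_mul]
    refine Finset.sum_le_sum fun j _ => ?_
    rcases eq_or_ne i j with rfl | hij
    · exact le_rfl
    · exact mul_le_mul_of_nonpos_left (hi j (Finset.mem_univ j)) (hoff i j hij)
  exact nonneg_of_mul_nonneg_right ((hx i).trans hle) (hrow i)

theorem isUnit_det_of_row_sum_pos [DecidableEq n] {M : Matrix n n ℝ}
    (hoff : ∀ i j, i ≠ j → M i j ≤ 0) (hrow : ∀ i, 0 < ∑ j, M i j) : IsUnit M.det := by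
  rw [isUnit_iff_ne_zero]
  intro hdet
  obtain ⟨v, hv, hMv⟩ := exists_mulVec_eq_zero_iff.mpr hdet
  refine hv (funext fun k => le_antisymm ?_ ?_)
  · have := nonneg_of_mulVec_nonneg hoff hrow (x := -v) (by simp [mulVec_neg, hMv]) k
    simpa using this
  · exact nonneg_of_mulVec_nonneg hoff hrow (by simp [hMv]) k

theorem inv_nonneg_of_row_sum_pos [DecidableEq n] {M : Matrix n n ℝ}
    (hoff : ∀ i j, i ≠ j → M i j ≤ 0) (hrow : ∀ i, 0 < ∑ j, M i j) (i j : n) :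
    0 ≤ M⁻¹ i j := by
  refine nonneg_of_mulVec_nonneg hoff hrow (x := fun k => M⁻¹ k j) (fun k => ?_) i
  change 0 ≤ (M * M⁻¹) k j
  rw [mul_nonsing_inv M (isUnit_det_of_row_sum_pos hoff hrow), one_apply]
  split_ifs <;> norm_num

end Matrix

/-- Summing a nonpositive constant over the indices satisfying a predicate with at most one
solution gives at least that constant. -/
theorem le_sum_ite_of_subsingleton {ι : Type*} [Fintype ι] {p : ι → Prop} [DecidablePred p]
    (hp : ∀ a b, p a → p b → a = b) {b : ℝ} (hb : b ≤ 0) :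
    b ≤ ∑ j, if p j then b else 0 := by
  rw [← Finset.sum_filter, Finset.sum_const, nsmul_eq_mul]
  have hcard : ((Finset.univ.filter p).card : ℝ) ≤ 1 := by
    exact_mod_cast Finset.card_le_one.mpr fun a ha c hc =>
      hp a c (Finset.mem_filter.mp ha).2 (Finset.mem_filter.mp hc).2
  nlinarith

theorem toepTm_row_sum_ge {σ : ℝ} (hσ : 4 ≤ 17 * σ) {N : ℕ} (i : Fin N) :
    (16 - 3 * σ) / 16 ≤ ∑ j, toepTm σ N i j := by
  have hB : (4 - 17 * σ) / 16 ≤ 0 := by linarith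
  have hsplit : ∀ j, toepTm σ N i j = (if i = j then (31 * σ + 8) / 16 else 0)
      + (if j.val = i.val + 1 then (4 - 17 * σ) / 16 else 0)
      + (if i.val = j.val + 1 then (4 - 17 * σ) / 16 else 0) := by
    intro j
    simp only [toepTm, Fin.ext_iff]
    split_ifs <;> first | omega | simp
  have hup := le_sum_ite_of_subsingleton (p := fun j : Fin N => j.val = i.val + 1)
    (fun a b ha hb => Fin.ext (by omega)) hB
  have hdown := le_sum_ite_of_subsingleton (p := fun j : Fin N => i.val = j.val + 1)
    (fun a b ha hb => Fin.ext (by omega)) hB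
  simp only [hsplit, Finset.sum_add_distrib, Finset.sum_ite_eq, Finset.mem_univ, if_true]
  linarith

/-- If 1 < σ ≤ (104√2 − 12)/79, then the tridiagonal Toeplitz matrix
`T_m` is monotone: it is invertible and every entry of its inverse is nonnegative. -/
theorem toepTm_monotone (σ : ℝ) (N : ℕ) (hN : 7 ≤ N)
    (hσ₁ : 1 < σ) (hσ₂ : σ ≤ (104 * Real.sqrt 2 - 12) / 79) :
    IsUnit (toepTm σ N).det ∧ ∀ i j : Fin N, 0 ≤ (toepTm σ N)⁻¹ i j := by
  have hsqrt : Real.sqrt 2 ≤ 2 := Real.sqrt_le_iff.mpr (by norm_num)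
  have hoff : ∀ i j, i ≠ j → toepTm σ N i j ≤ 0 := by
    intro i j hij
    rw [toepTm, if_neg (Fin.val_ne_of_ne hij)]
    split_ifs <;> linarith
  have hrow : ∀ i, 0 < ∑ j, toepTm σ N i j := fun i =>
    lt_of_lt_of_le (by linarith) (toepTm_row_sum_ge (by linarith) i)
  exact ⟨isUnit_det_of_row_sum_pos hoff hrow, inv_nonneg_of_row_sum_pos hoff hrow⟩
end

section
/- If 1 < σ ≤ (104√2 − 12)/79, then every complex root of the quartic polynomial p(z) = C z⁴ + B z³ + A z² + B z + C, with A = (31σ+8)/16, B = (4−17σ)/16, C = (σ−1)/4, is a real number and is strictly positive. -/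
/-- A complex root of `z² - w z + 1` with `w > 2` real is real and strictly positive. -/
lemma im_eq_zero_and_re_pos_of_sq_sub_mul_add_one_eq_zero {w : ℝ} (hw : 2 < w) {z : ℂ}
    (h : z ^ 2 - (w : ℂ) * z + 1 = 0) : z.im = 0 ∧ 0 < z.re := by
  have hre : z.re ^ 2 - z.im ^ 2 - w * z.re + 1 = 0 := by
    have := congrArg Complex.re h
    simp [pow_two] at this
    linarith
  have him : z.im * (2 * z.re - w) = 0 := by
    have := congrArg Complex.im h
    simp [pow_two] at this
    linarith
  have hy : z.im = 0 := by
    rcases mul_eq_zero.mp him with h0 | h0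
    · exact h0
    · have hx : z.re = w / 2 := by linarith
      rw [hx] at hre
      nlinarith [sq_nonneg z.im]
  refine ⟨hy, ?_⟩
  rw [hy] at hre
  nlinarith [sq_nonneg z.re]

/-- If 1 < σ ≤ (104√2 − 12)/79, then every complex root of the quartic
p(z) = C z⁴ + B z³ + A z² + B z + C, with A = (31σ+8)/16, B = (4−17σ)/16, C = (σ−1)/4,
is a real number and is strictly positive. -/
theorem quartic_roots_real_positive (σ : ℝ) (hσ₁ : 1 < σ)
    (hσ₂ : σ ≤ (104 * Real.sqrt 2 - 12) / 79)
    (A B C : ℝ) (hA : A = (31*σ + 8)/16) (hB : B = (4 - 17*σ)/16) (hC : C = (σ - 1)/4) :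
    ∀ z : ℂ, (C : ℂ)*z^4 + (B : ℂ)*z^3 + (A : ℂ)*z^2 + (B : ℂ)*z + (C : ℂ) = 0 →
      z.im = 0 ∧ 0 < z.re := by
  intro z hz
  subst hA hB hC
  have hdisc : 0 ≤ -79 * σ ^ 2 - 24 * σ + 272 := by
    have h2 : Real.sqrt 2 ^ 2 = 2 := Real.sq_sqrt (by norm_num)
    have h1 : 79 * σ + 12 ≤ 104 * Real.sqrt 2 := by linarith
    nlinarith [pow_le_pow_left₀ (by linarith) h1 2]
  obtain ⟨s, hs0, hs⟩ : ∃ s : ℝ, 0 ≤ s ∧ s ^ 2 = -79 * σ ^ 2 - 24 * σ + 272 :=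
    ⟨_, Real.sqrt_nonneg _, Real.sq_sqrt hdisc⟩
  have hlt : s < σ + 12 := by nlinarith
  have hd : 0 < 8 * (σ - 1) := by linarith
  have hσ : (σ : ℂ) - 1 ≠ 0 := by
    exact_mod_cast (sub_pos.mpr hσ₁).ne'
  have hsC : (s : ℂ) ^ 2 = -79 * (σ : ℂ) ^ 2 - 24 * σ + 272 := by exact_mod_cast hs
  have hfac : (z ^ 2 - (((17 * σ - 4 - s) / (8 * (σ - 1)) : ℝ) : ℂ) * z + 1) *
      (z ^ 2 - (((17 * σ - 4 + s) / (8 * (σ - 1)) : ℝ) : ℂ) * z + 1) = 0 := by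
    push_cast at hz ⊢
    field_simp
    linear_combination (256 * ((σ : ℂ) - 1)) * hz - z ^ 2 * hsC
  rcases mul_eq_zero.mp hfac with h | h
  · exact im_eq_zero_and_re_pos_of_sq_sub_mul_add_one_eq_zero
      (by rw [lt_div_iff₀ hd]; linarith) h
  · exact im_eq_zero_and_re_pos_of_sq_sub_mul_add_one_eq_zero
      (by rw [lt_div_iff₀ hd]; linarith) h
end

section
/- If σ + ε = 1 and 1 < σ ≤ (104√2 − 12)/79, then the Toeplitz matrix T_M is monotone: it is invertible and every entry of its inverse is nonnegative. -/
open Matrix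

/-- A positive definite real matrix with nonpositive off-diagonal entries (a Stieltjes matrix)
has an entrywise nonnegative inverse. -/
theorem Matrix.PosDef.inv_nonneg_of_offDiag_nonpos {n : Type*} [Fintype n] [DecidableEq n]
    {W : Matrix n n ℝ} (hW : W.PosDef) (hoff : ∀ i j, i ≠ j → W i j ≤ 0) (i j : n) :
    0 ≤ W⁻¹ i j := by
  set x : n → ℝ := fun k => W⁻¹ k j
  have hWx : ∀ k, 0 ≤ (W *ᵥ x) k := by
    intro k
    have h : (W *ᵥ x) k = (W * W⁻¹) k j := rfl
    rw [h, Matrix.mul_nonsing_inv W ((Matrix.isUnit_iff_isUnit_det W).1 hW.isUnit),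
      Matrix.one_apply]
    split_ifs <;> norm_num
  set u : n → ℝ := fun k => max (-x k) 0 with hu
  have hu0 : ∀ k, 0 ≤ u k := fun k => le_max_right _ _
  have hxu : ∀ k, 0 ≤ x k + u k := fun k => by
    have := le_max_left (-x k) 0
    simp only [hu]; linarith
  have hmul : ∀ k, u k * (x k + u k) = 0 := fun k => by
    simp only [hu]
    rcases le_total (-x k) 0 with h | h
    · rw [max_eq_right h]; ring
    · rw [max_eq_left h]; ring
  have hquad : u ⬝ᵥ (W *ᵥ u) ≤ 0 := by
    refine Finset.sum_nonpos fun k _ => ?_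
    have h1 : u k * (W *ᵥ (x + u)) k ≤ 0 := by
      rw [Matrix.mulVec, dotProduct, Finset.mul_sum]
      refine Finset.sum_nonpos fun l _ => ?_
      rcases eq_or_ne k l with rfl | hkl
      · have := hmul k
        rw [Pi.add_apply, mul_left_comm, this, mul_zero]
      · exact mul_nonpos_of_nonneg_of_nonpos (hu0 k)
          (mul_nonpos_of_nonpos_of_nonneg (hoff k l hkl) (hxu l))
    rw [Matrix.mulVec_add, Pi.add_apply, mul_add] at h1
    have h2 := mul_nonneg (hu0 k) (hWx k)
    linarith
  have hzero : u = 0 := by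
    by_contra hne
    have := hW.dotProduct_mulVec_pos hne
    rw [star_trivial] at this
    linarith
  have := hxu i
  rw [hzero] at this
  simpa using this

/-- A real symmetric matrix which is strictly diagonally dominant with positive diagonal is
positive definite. -/
theorem Matrix.IsHermitian.posDef_of_sum_row_lt_diag {n : Type*} [Fintype n] [DecidableEq n]
    {T : Matrix n n ℝ} (hT : T.IsHermitian)
    (hdom : ∀ i, ∑ j ∈ Finset.univ.erase i, ‖T i j‖ < T i i) : T.PosDef := by
  rw [hT.posDef_iff_eigenvalues_pos]
  intro i
  have hev : Module.End.HasEigenvalue (Matrix.toLin' T) (hT.eigenvalues i) := by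
    rw [Module.End.hasEigenvalue_iff_mem_spectrum, Matrix.spectrum_toLin']
    exact hT.eigenvalues_mem_spectrum_real i
  obtain ⟨k, hk⟩ := eigenvalue_mem_ball hev
  rw [Metric.mem_closedBall, Real.dist_eq] at hk
  have := (abs_le.1 hk).1
  have := hdom k
  linarith

theorem sum_indicator_le {n : Type*} [Fintype n] {p : n → Prop} [DecidablePred p]
    (hp : ∀ a b, p a → p b → a = b) {c : ℝ} (hc : 0 ≤ c) :
    ∑ j, (if p j then c else 0) ≤ c := by
  rw [← Finset.sum_filter, Finset.sum_const, nsmul_eq_mul]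
  have h : (Finset.univ.filter p).card ≤ 1 :=
    Finset.card_le_one.2 fun a ha b hb =>
      hp a b (Finset.mem_filter.1 ha).2 (Finset.mem_filter.1 hb).2
  have h' : ((Finset.univ.filter p).card : ℝ) ≤ 1 := by exact_mod_cast h
  nlinarith

theorem toepTM_isHermitian (σ : ℝ) (N : ℕ) : (toepTM σ N).IsHermitian := by
  ext i j
  simp only [Matrix.conjTranspose_apply, star_trivial, toepTM, eq_comm, or_comm]

theorem toepTM_posDef {σ : ℝ} (h₁ : 1 < σ) (h₂ : σ < 24 / 11) (N : ℕ) :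
    (toepTM σ N).PosDef := by
  refine (toepTM_isHermitian σ N).posDef_of_sum_row_lt_diag fun i => ?_
  have hb : 0 ≤ (17 * σ - 4) / 16 := by linarith
  have hc : 0 ≤ (σ - 1) / 4 := by linarith
  have hle : ∑ j ∈ Finset.univ.erase i, ‖toepTM σ N i j‖ ≤
      ∑ j : Fin N, (((if j.val = i.val + 1 then (17 * σ - 4) / 16 else 0)
        + (if i.val = j.val + 1 then (17 * σ - 4) / 16 else 0))
        + ((if j.val = i.val + 2 then (σ - 1) / 4 else 0)
        + (if i.val = j.val + 2 then (σ - 1) / 4 else 0))) := by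
    refine (Finset.sum_le_sum fun j hj => ?_).trans
      (Finset.sum_le_sum_of_subset_of_nonneg (Finset.erase_subset i _) fun j _ _ => ?_)
    · have hji : i.val ≠ j.val := fun h => (Finset.mem_erase.1 hj).1 (Fin.ext h.symm)
      have hB : |(4 - 17 * σ) / 16| = (17 * σ - 4) / 16 := by
        rw [abs_of_nonpos (by linarith)]; ring
      simp only [toepTM, if_neg hji, Real.norm_eq_abs]
      split_ifs <;> first | omega | simp [hB, abs_of_nonneg hc]
    · split_ifs <;> linarith
  simp only [Finset.sum_add_distrib] at hle
  have e1 := sum_indicator_le (p := fun j : Fin N => j.val = i.val + 1)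
    (fun a b ha hb => Fin.ext (by omega)) hb
  have e2 := sum_indicator_le (p := fun j : Fin N => i.val = j.val + 1)
    (fun a b ha hb => Fin.ext (by omega)) hb
  have e3 := sum_indicator_le (p := fun j : Fin N => j.val = i.val + 2)
    (fun a b ha hb => Fin.ext (by omega)) hc
  have e4 := sum_indicator_le (p := fun j : Fin N => i.val = j.val + 2)
    (fun a b ha hb => Fin.ext (by omega)) hc
  have hd : toepTM σ N i i = (31 * σ + 8) / 16 := by simp [toepTM]
  rw [hd]
  linarith

/-- The sequence `s ^ (k + 1) - 1` is a subsolution of the pentadiagonal recurrence as soon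
as the symbol of the matrix is nonpositive at `s`. -/
theorem sum_toeplitz_mul_pow_sub_one_nonpos {A B C s : ℝ} (hs : 1 < s) (hC : 0 ≤ C)
    (hsym : A * s ^ 2 + B * (s + s ^ 3) + C * (1 + s ^ 4) ≤ 0)
    (hone : 0 ≤ A + 2 * B + C) {i l : ℕ} (hil : l < i) :
    ∑ k ∈ Finset.range (i + 1), (s ^ (k + 1) - 1) *
      (if k = l then A else if l = k + 1 ∨ k = l + 1 then B
        else if l = k + 2 ∨ k = l + 2 then C else 0) ≤ 0 := by
  have hpow : ∀ n : ℕ, 0 ≤ s ^ n - 1 := fun n => by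
    have := one_le_pow₀ hs.le (n := n)
    linarith
  have hsplit : ∀ k, (s ^ (k + 1) - 1) *
      (if k = l then A else if l = k + 1 ∨ k = l + 1 then B
        else if l = k + 2 ∨ k = l + 2 then C else 0) =
      (if k = l then (s ^ (k + 1) - 1) * A else 0)
      + (if k = l + 1 then (s ^ (k + 1) - 1) * B else 0)
      + (if k = l + 2 then (s ^ (k + 1) - 1) * C else 0)
      + (if l = k + 1 then (s ^ (k + 1) - 1) * B else 0)
      + (if l = k + 2 then (s ^ (k + 1) - 1) * C else 0) := by
    intro k
    split_ifs <;> first | omega | ring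
  simp only [hsplit, Finset.sum_add_distrib, Finset.sum_ite_eq', Finset.mem_range]
  rw [if_pos (by omega), if_pos (by omega)]
  have hlast : (if l + 2 < i + 1 then (s ^ (l + 2 + 1) - 1) * C else 0) ≤
      (s ^ (l + 2 + 1) - 1) * C := by
    split_ifs
    · exact le_rfl
    · exact mul_nonneg (hpow _) hC
  match l, hil, hlast with
  | 0, hil, hlast =>
    have h1 : ∀ k, ¬ (0 = k + 1) := by omega
    simp only [h1, if_false, Finset.sum_const_zero]
    have key : s * ((s - 1) * A + (s ^ 2 - 1) * B + (s ^ 3 - 1) * C) ≤ 0 := by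
      nlinarith [mul_nonneg (sub_nonneg.2 hs.le) hC, mul_nonneg (by linarith : 0 ≤ s) hone]
    have := nonpos_of_mul_nonpos_right key (by linarith)
    norm_num at hlast ⊢
    linarith
  | 1, hil, hlast =>
    have h1 : ∀ k, (1 = k + 1) ↔ k = 0 := by omega
    simp only [h1, Nat.add_one_ne_zero, if_false, Finset.sum_const_zero, Finset.sum_ite_eq', Finset.mem_range]
    rw [if_pos (by omega : 0 < i + 1)]
    norm_num at hlast ⊢
    nlinarith
  | m + 2, hil, hlast =>
    have h1 : ∀ k, (m + 2 = k + 1) ↔ k = m + 1 := by omega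
    simp only [h1, Nat.add_right_cancel_iff, Finset.sum_ite_eq', Finset.mem_range]
    rw [if_pos (by omega : m + 1 < i + 1), if_pos (by omega : m < i + 1)]
    have h3 : s ^ (m + 1) * (A * s ^ 2 + B * (s + s ^ 3) + C * (1 + s ^ 4)) ≤ 0 :=
      mul_nonpos_of_nonneg_of_nonpos (by positivity) hsym
    ring_nf at h3 hlast ⊢
    linarith

theorem exists_toepTM_symbol_nonpos {σ : ℝ} (h₁ : 1 < σ)
    (h₂ : σ ≤ (104 * Real.sqrt 2 - 12) / 79) :
    ∃ s : ℝ, 1 < s ∧ (31 * σ + 8) / 16 * s ^ 2 + (4 - 17 * σ) / 16 * (s + s ^ 3)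
      + (σ - 1) / 4 * (1 + s ^ 4) ≤ 0 := by
  set r := Real.sqrt 2 with hr
  have hr2 : r ^ 2 = 2 := Real.sq_sqrt (by norm_num)
  have hr1 : 1 < r := by
    rw [hr, Real.lt_sqrt] <;> norm_num
  have hD : Real.sqrt ((3 + r) ^ 2 - 4) ^ 2 = (3 + r) ^ 2 - 4 := Real.sq_sqrt (by nlinarith)
  have hD0 := Real.sqrt_nonneg ((3 + r) ^ 2 - 4)
  set s := ((3 + r) + Real.sqrt ((3 + r) ^ 2 - 4)) / 2 with hs
  have hs2 : 1 + s ^ 2 = (3 + r) * s := by rw [hs]; nlinarith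
  refine ⟨s, by linarith, ?_⟩
  have hx : (31 * σ + 8) / 16 + (4 - 17 * σ) / 16 * (3 + r)
      + (σ - 1) / 4 * ((3 + r) ^ 2 - 2) ≤ 0 := by
    nlinarith
  have hs4 : 1 + s ^ 4 = ((3 + r) ^ 2 - 2) * s ^ 2 := by
    linear_combination (1 + s ^ 2 + (3 + r) * s) * hs2
  have hs3 : s + s ^ 3 = (3 + r) * s ^ 2 := by linear_combination s * hs2
  rw [hs3, hs4]
  nlinarith [mul_nonneg (neg_nonneg.2 hx) (sq_nonneg s)]

/-- If σ + ε = 1 and 1 < σ ≤ (104√2 − 12)/79, then the Toeplitz matrix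
`T_M` is monotone: it is invertible and every entry of its inverse is nonnegative. -/
theorem toepTM_monotone (ε σ : ℝ) (N : ℕ) (hN : 7 ≤ N)
    (hεσ : σ + ε = 1) (hσ₁ : 1 < σ) (hσ₂ : σ ≤ (104 * Real.sqrt 2 - 12) / 79) :
    IsUnit (toepTM σ N).det ∧ ∀ i j : Fin N, 0 ≤ (toepTM σ N)⁻¹ i j := by
  obtain ⟨s, hs, hsym⟩ := exists_toepTM_symbol_nonpos hσ₁ hσ₂
  have hσ₃ : σ < 24 / 11 := by
    have : Real.sqrt 2 < 3 / 2 := by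
      rw [Real.sqrt_lt] <;> norm_num
    linarith
  have hT := toepTM_posDef hσ₁ hσ₃ N
  have hTu := (Matrix.isUnit_iff_isUnit_det _).1 hT.isUnit
  refine ⟨hTu, ?_⟩
  set T := toepTM σ N with hTdef
  have hv : ∀ k : ℕ, 0 < s ^ (k + 1) - 1 := fun k => by
    have := one_lt_pow₀ hs (Nat.add_one_ne_zero k)
    linarith
  -- The congruence by `Q` turns `T` into a Stieltjes matrix.
  let Q : Matrix (Fin N) (Fin N) ℝ :=
    fun i k => if k.val < i.val + 1 then s ^ (k.val + 1) - 1 else 0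
  have hQ0 : ∀ i k, 0 ≤ Q i k := fun i k => by
    simp only [Q]
    split_ifs
    · exact (hv _).le
    · exact le_rfl
  have hQu : IsUnit Q.det := by
    have htri : Q.BlockTriangular OrderDual.toDual := fun i k hik => by
      have : i.val < k.val := hik
      simp only [Q]
      rw [if_neg (by omega)]
    rw [Matrix.det_of_isLowerTriangular Q htri, isUnit_iff_ne_zero, Finset.prod_ne_zero_iff]
    intro i _
    simp only [Q, if_pos (Nat.lt_succ_self _)]
    exact (hv _).ne'
  have hW : (Q * T * Qᵀ).PosDef := by
    have h := hT.mul_mul_conjTranspose_same (B := Q)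
      (Matrix.vecMul_injective_iff_isUnit.2 ((Matrix.isUnit_iff_isUnit_det Q).2 hQu))
    rwa [Matrix.conjTranspose_eq_transpose_of_trivial] at h
  have hQT : ∀ i l : Fin N, l < i → (Q * T) i l ≤ 0 := fun i l hil => by
    have h := sum_toeplitz_mul_pow_sub_one_nonpos hs (by linarith) hsym (by linarith)
      (show l.val < i.val from hil)
    refine le_of_eq_of_le ?_ h
    rw [Matrix.mul_apply]
    simp only [Q, hTdef, toepTM, ite_mul, zero_mul]
    rw [Fin.sum_univ_eq_sum_range (fun k => if k < i.val + 1 then (s ^ (k + 1) - 1) *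
      (if k = l.val then (31*σ + 8)/16 else if l.val = k + 1 ∨ k = l.val + 1 then (4 - 17*σ)/16
        else if l.val = k + 2 ∨ k = l.val + 2 then (σ - 1)/4 else 0) else 0) N,
      ← Finset.sum_filter]
    congr 1
    ext k
    simp only [Finset.mem_filter, Finset.mem_range]
    omega
  have hlow : ∀ i j : Fin N, j < i → (Q * T * Qᵀ) i j ≤ 0 := fun i j hji => by
    rw [Matrix.mul_apply]
    refine Finset.sum_nonpos fun l _ => ?_
    rw [Matrix.transpose_apply]
    rcases lt_or_ge l i with hl | hl
    · exact mul_nonpos_of_nonpos_of_nonneg (hQT i l hl) (hQ0 j l)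
    · have : ¬ l.val < j.val + 1 := by
        have h1 : j.val < i.val := hji
        have h2 : i.val ≤ l.val := hl
        omega
      simp only [Q, if_neg this, mul_zero, le_refl]
  have hoff : ∀ i j : Fin N, i ≠ j → (Q * T * Qᵀ) i j ≤ 0 := fun i j hij => by
    rcases lt_or_gt_of_ne hij with h | h
    · rw [← hW.isHermitian.apply i j, star_trivial]
      exact hlow j i h
    · exact hlow i j h
  have hinv : T⁻¹ = Qᵀ * (Q * T * Qᵀ)⁻¹ * Q := by
    have hQtu : IsUnit (Qᵀ).det := by rwa [Matrix.det_transpose]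
    rw [Matrix.mul_inv_rev, Matrix.mul_inv_rev, Matrix.mul_nonsing_inv_cancel_left _ _ hQtu,
      Matrix.nonsing_inv_mul_cancel_right _ _ hQu]
  intro i j
  rw [hinv, Matrix.mul_apply]
  refine Finset.sum_nonneg fun k _ => mul_nonneg ?_ (hQ0 k j)
  rw [Matrix.mul_apply]
  exact Finset.sum_nonneg fun l _ =>
    mul_nonneg (hQ0 l i) (hW.inv_nonneg_of_offDiag_nonpos hoff l k)
end
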